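/- arXiv:2507.16908 — 4 statements merged into one kernel-verified Lean document; each statement's English description precedes it below -/
import Mathlib

section
/- Let R be a commutative ring, n a natural number, and K : Fin(n+1) → Fin(n+1) → R a function such that for all pairwise distinct i, j, k one has K i j · K i k = K i j · K j k + K i k · K k j. Let p : Fin(n+1) → Fin(n+1) satisfy p 0 = 0 and p i < i for every i ≠ 0, so that p encodes a rooted tree on the vertex set {0,…,n} with root 0 in which p i is the parent of i. Then ∏_{i=1}^{n} K (p i) i = ∑_v ∏_{k=1}^{n} K (v(k−1)) (v k), where the sum ranges over all bijections v of {0,…,n} with v(0) = 0 such that for every k ∈ {1,…,n} there exists m < k with v(m) = p(v(k)) (i.e., v enumerates the vertices so that every vertex appears strictly after its parent). -/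
/-- The product of `K` over consecutive entries of a list. -/
def chainProd {α R : Type*} [CommRing R] (K : α → α → R) : List α → R
  | [] => 1
  | [_] => 1
  | a :: b :: t => K a b * chainProd K (b :: t)

section chainProd

variable {α R : Type*} [CommRing R] (K : α → α → R)

theorem chainProd_append_cons (l : List α) (a : α) (t : List α) :
    chainProd K (l ++ a :: t) = chainProd K (l ++ [a]) * chainProd K (a :: t) := by
  induction l with
  | nil => simp [chainProd]
  | cons b l ih =>
    cases l with
    | nil => simp [chainProd]
    | cons c l => simpa [chainProd, mul_assoc] using congrArg (K b c * ·) ih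

theorem chainProd_ofFn (n : ℕ) (f : Fin (n + 1) → α) :
    chainProd K (List.ofFn f) = ∏ k : Fin n, K (f k.castSucc) (f k.succ) := by
  induction n with
  | zero => simp [chainProd]
  | succ n ih =>
    have h := ih fun i => f i.succ
    rw [List.ofFn_succ] at h
    rw [List.ofFn_succ, List.ofFn_succ, chainProd, h, Fin.prod_univ_succ]
    simp

/-- Attaching `x` to the first vertex of a chain amounts to summing over all insertions of `x`
after that vertex. -/
theorem sum_chainProd_permutations'Aux
    (hK : ∀ i j k, i ≠ j → i ≠ k → j ≠ k → K i j * K i k = K i j * K j k + K i k * K k j)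
    (x : α) (t : List α) (a : α) (hn : (a :: t).Nodup) (hx : x ∉ a :: t) :
    ((t.permutations'Aux x).map fun u => chainProd K (a :: u)).sum
      = K a x * chainProd K (a :: t) := by
  induction t generalizing a with
  | nil => simp [chainProd]
  | cons b t ih =>
    have h := ih b hn.of_cons fun h => hx (List.mem_cons_of_mem _ h)
    simp only [List.mem_cons, not_or, List.nodup_cons] at hx hn
    have h3 := hK a x b (Ne.symm hx.1) hn.1.1 hx.2.1
    simp only [List.permutations'Aux, List.map_cons, List.sum_cons, List.map_map,
      Function.comp_def, chainProd, List.sum_map_mul_left, h]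
    linear_combination (-chainProd K (b :: t)) * h3

end chainProd

section Lists

variable {α : Type*} [DecidableEq α]

theorem List.mem_permutations'Aux_iff_erase {x : α} {l : List α} (hx : x ∉ l) (l' : List α) :
    l' ∈ l.permutations'Aux x ↔ x ∈ l' ∧ l'.erase x = l := by
  induction l generalizing l' with
  | nil =>
    cases l' with
    | nil => simp
    | cons c t => by_cases hc : c = x <;> simp [hc, eq_comm (a := x)]
  | cons b l ih =>
    simp only [List.mem_cons, not_or] at hx
    cases l' with
    | nil => simp
    | cons c t =>
      by_cases hc : c = x
      · subst hc
        simp [Ne.symm hx.1]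
      · have := ih hx.2 t
        simp only [List.permutations'Aux, List.mem_cons, List.mem_map, List.cons.injEq]
        grind

theorem List.mem_map_append_permutations'Aux {x a : α} {s t : List α}
    (hn : (s ++ a :: t).Nodup) (hx : x ∉ s ++ a :: t) (l' : List α) :
    l' ∈ (t.permutations'Aux x).map (fun u => s ++ a :: u) ↔
      [a, x].Sublist l' ∧ l'.erase x = s ++ a :: t := by
  have hxa : x ≠ a := by rintro rfl; simp at hx
  induction s generalizing l' with
  | nil =>
    simp only [List.nil_append, List.mem_cons, not_or] at hx hn ⊢
    have key := List.mem_permutations'Aux_iff_erase hx.2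
    cases l' with
    | nil => simp
    | cons c u =>
      by_cases hc : c = x
      · subst hc
        simp
        grind
      · by_cases hca : c = a
        · subst hca
          simp [key, hc]
        · simp [hc, hca]
          grind
  | cons b s ih =>
    simp only [List.cons_append, List.mem_cons, not_or, List.nodup_cons] at hx hn ⊢
    have key := ih hn.2 hx.2
    have hba : a ≠ b := by rintro rfl; simp at hn
    cases l' with
    | nil => simp
    | cons c u =>
      have := key u
      by_cases hc : c = x
      · subst hc
        simp [Ne.symm hx.1]
        grind
      · simp only [List.mem_map, List.cons.injEq] at this ⊢
        have h2 : (c :: u).erase x = c :: u.erase x := by simp [hc]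
        rw [h2, List.cons.injEq]
        constructor
        · rintro ⟨w, hw, rfl, rfl⟩
          have := this.1 ⟨w, hw, rfl⟩
          exact ⟨this.1.cons _, rfl, this.2⟩
        · rintro ⟨h1, rfl, h3⟩
          have h4 : [a, x].Sublist u := by
            cases h1 with
            | cons _ h => exact h
            | cons_cons _ h => exact absurd rfl hba
          obtain ⟨w, hw, rfl⟩ := this.2 ⟨h4, h3⟩
          exact ⟨w, hw, rfl, rfl⟩

theorem List.pair_sublist_ofFn_iff {β : Type*} {n : ℕ} (f : Fin n → β) (a b : β) :
    [a, b].Sublist (List.ofFn f) ↔ ∃ i j, i < j ∧ f i = a ∧ f j = b := by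
  constructor
  · have : (List.ofFn f).Pairwise fun a b => ∃ i j, i < j ∧ f i = a ∧ f j = b :=
      List.pairwise_ofFn.2 fun i j h => ⟨i, j, h, rfl, rfl⟩
    exact fun h => List.pairwise_iff_forall_sublist.1 this h
  · rintro ⟨i, j, h, rfl, rfl⟩
    have : (List.ofFn f).Pairwise fun a b => [a, b].Sublist (List.ofFn f) :=
      List.pairwise_iff_forall_sublist.2 fun h => h
    exact List.pairwise_ofFn.1 this h

end Lists

/-- The enumerations of `s` in which every vertex other than `r` appears after its parent. -/
def treeOrders {α : Type*} [DecidableEq α] (p : α → α) (r : α) (s : Finset α) :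
    Finset (List α) :=
  s.1.lists.toFinset.filter fun l => ∀ y ∈ l, y ≠ r → [p y, y].Sublist l

section treeOrders

variable {α : Type*} [DecidableEq α] {p : α → α} {r : α}

theorem mem_treeOrders {s : Finset α} {l : List α} :
    l ∈ treeOrders p r s ↔ s.1 = ↑l ∧ ∀ y ∈ l, y ≠ r → [p y, y].Sublist l := by
  simp [treeOrders]

theorem nodup_of_mem_treeOrders {s : Finset α} {l : List α} (h : l ∈ treeOrders p r s) :
    l.Nodup := by
  rw [← Multiset.coe_nodup, ← (mem_treeOrders.1 h).1]
  exact s.2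

theorem mem_iff_of_mem_treeOrders {s : Finset α} {l : List α} (h : l ∈ treeOrders p r s) {y : α} :
    y ∈ l ↔ y ∈ s := by
  rw [← Multiset.mem_coe, ← (mem_treeOrders.1 h).1, Finset.mem_val]

/-- Orders of a tree enlarged by a leaf `x` are the orders of the tree with `x` inserted somewhere
after its parent. -/
theorem mem_treeOrders_insert_iff {s : Finset α} {x : α} (hx : x ∉ s) (hxr : x ≠ r)
    (hps : ∀ y ∈ s, y ≠ r → p y ≠ x) (l : List α) :
    l ∈ treeOrders p r (insert x s) ↔ [p x, x].Sublist l ∧ l.erase x ∈ treeOrders p r s := by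
  simp only [mem_treeOrders, Finset.insert_val_of_notMem hx]
  constructor
  · rintro ⟨h1, h2⟩
    have hxl : x ∈ l := by rw [← Multiset.mem_coe, ← h1]; simp
    have h3 : s.1 = ↑(l.erase x) := by
      rw [← Multiset.coe_erase, ← h1, Multiset.erase_cons_head]
    refine ⟨h2 x hxl hxr, h3, fun y hy hyr => ?_⟩
    have hys : y ∈ s := by rwa [← Finset.mem_val, h3, Multiset.mem_coe]
    have hyx : y ≠ x := fun h => hx (h ▸ hys)
    have := (h2 y (List.mem_of_mem_erase hy) hyr).erase x
    rwa [List.erase_of_not_mem (by simp [hyx.symm, (hps y hys hyr).symm])] at this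
  · rintro ⟨h1, h2, h3⟩
    have hxl : x ∈ l := h1.subset (by simp)
    refine ⟨?_, fun y hy hyr => ?_⟩
    · rw [h2, ← Multiset.coe_erase, Multiset.cons_erase (by simpa using hxl)]
    · by_cases hyx : y = x
      · rwa [hyx]
      · exact (h3 y ((List.mem_erase_of_ne hyx).2 hy) hyr).trans List.erase_sublist

variable {R : Type*} [CommRing R] (K : α → α → R)

theorem sum_treeOrders_insert
    (hK : ∀ i j k, i ≠ j → i ≠ k → j ≠ k → K i j * K i k = K i j * K j k + K i k * K k j)
    {s : Finset α} {x : α} (hx : x ∉ s) (hxr : x ≠ r)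
    (hpx : p x ∈ s) (hps : ∀ y ∈ s, y ≠ r → p y ≠ x) :
    ∑ l ∈ treeOrders p r (insert x s), chainProd K l
      = K (p x) x * ∑ l ∈ treeOrders p r s, chainProd K l := by
  have hmem := mem_treeOrders_insert_iff hx hxr hps
  rw [← Finset.sum_fiberwise_of_maps_to (g := fun l : List α => l.erase x)
    fun l hl => ((hmem l).1 hl).2, Finset.mul_sum]
  refine Finset.sum_congr rfl fun l hl => ?_
  have hxl : x ∉ l := fun h => hx ((mem_iff_of_mem_treeOrders hl).1 h)
  have hn := nodup_of_mem_treeOrders hl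
  obtain ⟨u, t, rfl⟩ := List.append_of_mem ((mem_iff_of_mem_treeOrders hl).2 hpx)
  have hxt : x ∉ p x :: t := fun h => hxl (List.mem_append_right _ h)
  have hfib : (treeOrders p r (insert x s)).filter (fun l => l.erase x = u ++ p x :: t)
      = ((t.permutations'Aux x).map fun w => u ++ p x :: w).toFinset := by
    ext l'
    rw [List.mem_toFinset, List.mem_map_append_permutations'Aux hn hxl, Finset.mem_filter, hmem]
    constructor
    · exact fun h => ⟨h.1.1, h.2⟩
    · exact fun h => ⟨⟨h.1, h.2 ▸ hl⟩, h.2⟩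
  have hnd : ((t.permutations'Aux x).map fun w => u ++ p x :: w).Nodup := by
    refine List.Nodup.map (fun w w' h => by simpa using h) ?_
    exact List.nodup_permutations'Aux_of_notMem _ _ fun h => hxt (List.mem_cons_of_mem _ h)
  rw [hfib, List.sum_toFinset _ hnd, List.map_map]
  have hcomp : (chainProd K ∘ fun w => u ++ p x :: w)
      = fun w => chainProd K (u ++ [p x]) * chainProd K (p x :: w) :=
    funext (chainProd_append_cons K u (p x))
  rw [hcomp, chainProd_append_cons K u (p x) t, List.sum_map_mul_left, sum_chainProd_permutations'Aux K hK x t (p x)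
    (hn.sublist (List.sublist_append_right _ _)) hxt]
  ring

theorem sum_treeOrders_singleton : ∑ l ∈ treeOrders p r {r}, chainProd K l = 1 := by
  have : treeOrders p r {r} = {[r]} := by
    ext l
    rw [mem_treeOrders, Finset.singleton_val, Finset.mem_singleton, eq_comm,
      Multiset.coe_eq_singleton]
    constructor
    · exact fun h => h.1
    · rintro rfl
      simp
  rw [this, Finset.sum_singleton, chainProd]

theorem prod_parent_eq_sum_treeOrders {α : Type*} [LinearOrder α] {p : α → α} {r : α}
    (K : α → α → R)
    (hK : ∀ i j k, i ≠ j → i ≠ k → j ≠ k → K i j * K i k = K i j * K j k + K i k * K k j)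
    (hr : ∀ i, r ≤ i) (hp : ∀ i, i ≠ r → p i < i) (s : Finset α) (hrs : r ∈ s)
    (hs : ∀ i ∈ s, i ≠ r → p i ∈ s) :
    ∏ i ∈ s.erase r, K (p i) i = ∑ l ∈ treeOrders p r s, chainProd K l := by
  induction s using Finset.induction_on_max with
  | empty => simp at hrs
  | insert x s hmax ih =>
    have hx : x ∉ s := fun h => lt_irrefl _ (hmax x h)
    by_cases hxr : x = r
    · subst hxr
      have : s = ∅ := Finset.eq_empty_of_forall_notMem fun y hy => (hmax y hy).not_ge (hr y)
      subst this
      simpa using (sum_treeOrders_singleton (p := p) K).symm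
    · have hrs' : r ∈ s := (Finset.mem_insert.1 hrs).resolve_left (Ne.symm hxr)
      have hs' : ∀ i ∈ s, i ≠ r → p i ≠ x := fun i hi hir =>
        ((hp i hir).trans (hmax i hi)).ne
      have hpx : p x ∈ s :=
        (Finset.mem_insert.1 (hs x (Finset.mem_insert_self _ _) hxr)).resolve_left (hp x hxr).ne
      rw [sum_treeOrders_insert K hK hx hxr hpx hs', ← ih hrs' fun i hi hir =>
        (Finset.mem_insert.1 (hs i (Finset.mem_insert_of_mem hi) hir)).resolve_left (hs' i hi hir),
        Finset.erase_insert_of_ne hxr, Finset.prod_insert fun h => hx (Finset.mem_of_mem_erase h)]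

end treeOrders

theorem ofFn_mem_treeOrders_iff {n : ℕ} {p : Fin (n + 1) → Fin (n + 1)}
    (v : Equiv.Perm (Fin (n + 1))) :
    List.ofFn v ∈ treeOrders p 0 Finset.univ ↔
      v 0 = 0 ∧ ∀ k : Fin n, ∃ m : Fin (n + 1), m < k.succ ∧ v m = p (v k.succ) := by
  have huniv : (Finset.univ : Finset (Fin (n + 1))).1 = ↑(List.ofFn v) := by
    refine (Multiset.Nodup.ext Finset.univ.2 (Multiset.coe_nodup.2
      (List.nodup_ofFn.2 v.injective))).2 fun a => ?_
    exact ⟨fun _ => Multiset.mem_coe.2 (List.mem_ofFn.2 (v.surjective a)),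
      fun _ => Finset.mem_univ a⟩
  rw [mem_treeOrders]
  simp only [huniv, true_and, List.pair_sublist_ofFn_iff]
  constructor
  · intro h
    have key : ∀ k, v k ≠ 0 → ∃ m < k, v m = p (v k) := by
      intro k hk
      obtain ⟨i, j, hij, h1, h2⟩ := h (v k) (List.mem_ofFn.2 ⟨k, rfl⟩) hk
      exact ⟨i, v.injective h2 ▸ hij, h1⟩
    have h0 : v 0 = 0 := by
      by_contra h0
      obtain ⟨m, hm, -⟩ := key 0 h0
      exact absurd hm (Fin.not_lt_zero m)
    exact ⟨h0, fun k => key _ fun hk => Fin.succ_ne_zero k (v.injective (hk.trans h0.symm))⟩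
  · rintro ⟨h0, h⟩ y - hy
    obtain ⟨k, rfl⟩ := v.surjective y
    obtain ⟨k, rfl⟩ := Fin.exists_succ_eq.2 (fun hk : k = 0 => hy (hk ▸ h0))
    obtain ⟨m, hm, hv⟩ := h k
    exact ⟨m, _, hm, hv, rfl⟩


/-- **Tree lemma (Lemma C.1).**
Let `R` be a commutative ring and `K : Fin (n+1) → Fin (n+1) → R` satisfy the
three-term identity `K i j · K i k = K i j · K j k + K i k · K k j` for pairwise
distinct `i, j, k`.  Let `p : Fin (n+1) → Fin (n+1)` be a parent map of a rooted
tree on `{0, …, n}` with root `0` (`p 0 = 0` and `p i < i` for `i ≠ 0`).  Then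
the product of `K` over the edges of the tree equals the sum, over all
enumerations `v` of the vertices starting at `0` in which every vertex appears
strictly after its parent, of the product of `K` along the corresponding linear
chain. -/
theorem tree_lemma {R : Type*} [CommRing R] (n : ℕ)
    (K : Fin (n + 1) → Fin (n + 1) → R)
    (hK : ∀ i j k : Fin (n + 1), i ≠ j → i ≠ k → j ≠ k →
      K i j * K i k = K i j * K j k + K i k * K k j)
    (p : Fin (n + 1) → Fin (n + 1))
    (hp0 : p 0 = 0) (hp : ∀ i : Fin (n + 1), i ≠ 0 → p i < i) :
    ∏ i : Fin n, K (p i.succ) i.succ =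
      ∑ v ∈ Finset.univ.filter (fun v : Equiv.Perm (Fin (n + 1)) =>
          v 0 = 0 ∧ ∀ k : Fin n, ∃ m : Fin (n + 1), m < k.succ ∧
            v m = p (v k.succ)),
        ∏ k : Fin n, K (v k.castSucc) (v k.succ) := by
  have hmain := prod_parent_eq_sum_treeOrders (r := 0) K hK Fin.zero_le hp Finset.univ
    (Finset.mem_univ _) fun _ _ _ => Finset.mem_univ _
  have hprod : ∏ i ∈ Finset.univ.erase 0, K (p i) i = ∏ i : Fin n, K (p i.succ) i.succ := by
    rw [Fin.univ_succ, Finset.erase_cons, Finset.prod_map]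
    rfl
  rw [← hprod, hmain]
  symm
  refine Finset.sum_bij (fun v _ => List.ofFn v)
    (fun v hv => (ofFn_mem_treeOrders_iff v).2 (Finset.mem_filter.1 hv).2)
    (fun v _ w _ h => DFunLike.coe_injective (List.ofFn_injective h)) (fun l hl => ?_)
    fun v _ => (chainProd_ofFn K n v).symm
  have hlen : l.length = n + 1 := by
    simpa using (congrArg Multiset.card (mem_treeOrders.1 hl).1).symm
  obtain ⟨f, rfl⟩ : ∃ f : Fin (n + 1) → Fin (n + 1), List.ofFn f = l :=
    ⟨fun i => l.get (i.cast hlen.symm), List.ext_get (by simp [hlen]) fun i h₁ h₂ => by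
      simp [-List.ofFn_succ]⟩
  have hf : Function.Injective f := List.nodup_ofFn.1 (nodup_of_mem_treeOrders hl)
  let v := Equiv.ofBijective f (Finite.injective_iff_bijective.1 hf)
  exact ⟨v, Finset.mem_filter.2 ⟨Finset.mem_univ _, (ofFn_mem_treeOrders_iff v).1 hl⟩, rfl⟩
end

section
/- Let n ≥ 1 and let t₀, t₁, …, tₙ be pairwise distinct complex numbers, with kernel 𝒦(s,t) = s·t/(t−s). Then ∏_{k=1}^{n} 𝒦(t₀, t_k) = ∑_σ ∏_{k=1}^{n} 𝒦(t_{σ(k−1)}, t_{σ(k)}), where the sum ranges over all bijections σ of {0,1,…,n} with σ(0) = 0. -/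
/-- The TBA kernel of Setup 1: `𝒦(s,t) = s·t/(t−s)`. -/
noncomputable def kernel1 (s t : ℂ) : ℂ := s * t / (t - s)

open Finset in
/-- Lagrange interpolation of `X ^ (#s - 1)`, written as a partial fraction expansion. -/
theorem prod_kernel1_eq_sum {ι : Type*} [DecidableEq ι] {s : Finset ι} (hs : s.Nonempty)
    {v : ι → ℂ} (hv : Function.Injective v) {a : ℂ} (ha : ∀ i, v i ≠ a) :
    ∏ k ∈ s, kernel1 a (v k) =
      ∑ j ∈ s, kernel1 a (v j) * ∏ k ∈ s.erase j, kernel1 (v j) (v k) := by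
  have interp : a ^ (#s - 1) =
      ∑ j ∈ s, v j ^ (#s - 1) * ∏ k ∈ s.erase j, (v k - a) / (v k - v j) := by
    have hdeg : (Polynomial.X ^ (#s - 1) : Polynomial ℂ).degree < #s := by
      rw [Polynomial.degree_X_pow]
      exact_mod_cast Nat.sub_lt hs.card_pos one_pos
    have h := congrArg (Polynomial.eval a)
      (Lagrange.eq_interpolate (v := v) hv.injOn hdeg)
    rw [Lagrange.interpolate_apply, Polynomial.eval_finsetSum] at h
    simp only [Polynomial.eval_mul, Polynomial.eval_C, Polynomial.eval_pow, Polynomial.eval_X,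
      Lagrange.basis, Polynomial.eval_prod, Lagrange.basisDivisor, Polynomial.eval_sub] at h
    rw [h]
    refine sum_congr rfl fun j _ => congrArg _ (prod_congr rfl fun k _ => ?_)
    rw [← neg_sub a, ← neg_sub (v j), neg_div_neg_eq, div_eq_inv_mul]
  have card_succ : #s = (#s - 1) + 1 := (Nat.sub_add_cancel hs.card_pos).symm
  have hne : ∏ k ∈ s, (v k - a) ≠ 0 := prod_ne_zero_iff.2 fun k _ => sub_ne_zero.2 (ha k)
  simp only [kernel1, prod_div_distrib, prod_mul_distrib, prod_const]
  rw [div_eq_iff hne, card_succ, pow_succ, interp, sum_mul, sum_mul, sum_mul]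
  refine sum_congr rfl fun j hj => ?_
  have hj0 : v j - a ≠ 0 := sub_ne_zero.2 (ha j)
  rw [← mul_prod_erase s v hj, ← mul_prod_erase s (fun k => v k - a) hj, card_erase_of_mem hj,
    prod_div_distrib]
  field_simp

theorem Fin.prod_swap_zero_succ {M : Type*} [CommMonoid M] {n : ℕ} (p : Fin (n + 1))
    (f : Fin (n + 1) → M) :
    ∏ i : Fin n, f (Equiv.swap 0 p i.succ) = ∏ k ∈ Finset.univ.erase p, f k := by
  have h := Equiv.prod_comp (Equiv.swap 0 p) (Function.update f p 1)
  rw [Fin.prod_univ_succ, ← Finset.mul_prod_erase _ _ (Finset.mem_univ p), Equiv.swap_apply_left,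
    Function.update_self, one_mul, one_mul] at h
  convert h using 1
  · refine Finset.prod_congr rfl fun i _ => (Function.update_of_ne (fun hi => ?_) _ _).symm
    exact Fin.succ_ne_zero i ((Equiv.swap 0 p).injective (hi.trans (Equiv.swap_apply_left 0 p).symm))
  · exact Finset.prod_congr rfl fun k hk =>
      (Function.update_of_ne (Finset.ne_of_mem_erase hk) _ _).symm

theorem prod_kernel1_eq_sum_perm (n : ℕ) (a : ℂ) (v : Fin n → ℂ) (hv : Function.Injective v)
    (ha : ∀ i, v i ≠ a) :
    ∏ k, kernel1 a (v k) =
      ∑ e : Equiv.Perm (Fin n), ∏ k : Fin n,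
        kernel1 (Fin.cons (α := fun _ => ℂ) a (v ∘ e) k.castSucc) (v (e k)) := by
  induction n generalizing a with
  | zero => simp
  | succ n ih =>
    rw [prod_kernel1_eq_sum Finset.univ_nonempty hv ha,
      ← Equiv.sum_comp Equiv.Perm.decomposeFin.symm, Fintype.sum_prod_type]
    refine Finset.sum_congr rfl fun p _ => ?_
    have hinj : Function.Injective fun i : Fin n => Equiv.swap 0 p i.succ :=
      (Equiv.swap 0 p).injective.comp (Fin.succ_injective n)
    have hne (i : Fin n) : v (Equiv.swap 0 p i.succ) ≠ v p := fun h =>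
      Fin.succ_ne_zero i
        ((Equiv.swap 0 p).injective ((hv h).trans (Equiv.swap_apply_left 0 p).symm))
    rw [← Fin.prod_swap_zero_succ p fun k => kernel1 (v p) (v k),
      ih (v p) (fun i => v (Equiv.swap 0 p i.succ)) (hv.comp hinj) hne, Finset.mul_sum]
    refine Finset.sum_congr rfl fun e _ => ?_
    have hcons (j : Fin (n + 1)) :
        Fin.cons (α := fun _ => ℂ) (v p) ((fun i => v (Equiv.swap 0 p i.succ)) ∘ e) j =
          v (Equiv.Perm.decomposeFin.symm (p, e) j) := by
      cases j using Fin.cases <;> simp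
    rw [Fin.prod_univ_succ]
    simp only [hcons, Fin.castSucc_zero, Fin.cons_zero, Equiv.Perm.decomposeFin_symm_apply_zero,
      ← Fin.succ_castSucc, Fin.cons_succ, Function.comp_apply,
      Equiv.Perm.decomposeFin_symm_apply_succ]

/-- **Star-shaped tree identity.**
For `n ≥ 1` and pairwise distinct complex numbers `t₀, t₁, …, tₙ`, with the
kernel `𝒦(s,t) = s·t/(t−s)`, one has
`∏_{k=1}^{n} 𝒦(t₀, t_k) = ∑_σ ∏_{k=1}^{n} 𝒦(t_{σ(k−1)}, t_{σ(k)})`,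
the sum running over all bijections `σ` of `{0,1,…,n}` with `σ(0) = 0`. -/
theorem star_tree_identity (n : ℕ) (hn : 1 ≤ n) (t : Fin (n + 1) → ℂ)
    (ht : Function.Injective t) :
    ∏ k : Fin n, kernel1 (t 0) (t k.succ) =
      ∑ σ ∈ Finset.univ.filter (fun σ : Equiv.Perm (Fin (n + 1)) => σ 0 = 0),
        ∏ k : Fin n, kernel1 (t (σ k.castSucc)) (t (σ k.succ)) := by
  rw [prod_kernel1_eq_sum_perm n (t 0) (fun i => t i.succ) (ht.comp (Fin.succ_injective n))
      fun i => ht.ne (Fin.succ_ne_zero i),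
    Finset.sum_filter, ← Equiv.sum_comp Equiv.Perm.decomposeFin.symm, Fintype.sum_prod_type,
    Fintype.sum_eq_single (0 : Fin (n + 1)) fun p hp => by simp [hp]]
  refine Finset.sum_congr rfl fun e _ => ?_
  have hcons (j : Fin (n + 1)) :
      Fin.cons (α := fun _ => ℂ) (t 0) ((fun i => t i.succ) ∘ e) j =
        t (Equiv.Perm.decomposeFin.symm (0, e) j) := by
    cases j using Fin.cases <;> simp
  simp [hcons]
end

section
/- Let s ≥ 1 be an integer and l₁, …, l_s ≥ 1 integers with n = l₁ + ⋯ + l_s. Then, as an identity of rational numbers, ∑ over all tuples (m₁,…,m_s) of integers with 1 ≤ m_a ≤ l_a for each a, of ((−1)^{m₁+⋯+m_s}/(m₁+⋯+m_s)) · ∏_{a=1}^{s} C(l_a−1, m_a−1) equals (−1)^s · (s−1)! · (n−s)! / n!, where C(·,·) denotes the binomial coefficient. -/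
open Polynomial in
/-- The functional `X ^ k ↦ (-1) ^ k / k` on polynomials, that is `p ↦ -∫ x in -1..0, p x / x`
for `p` divisible by `X`. -/
noncomputable def signedRecip : ℚ[X] →ₗ[ℚ] ℚ :=
  Polynomial.lsum fun k => ((-1 : ℚ) ^ k / k) • LinearMap.id

open Polynomial in
lemma signedRecip_C_mul_X_pow (c : ℚ) (k : ℕ) :
    signedRecip (C c * X ^ k) = (-1 : ℚ) ^ k / k * c := by
  rw [C_mul_X_pow_eq_monomial]
  simp [signedRecip, Polynomial.sum_monomial_index]

open Polynomial in
lemma signedRecip_X_pow_mul_one_add_X_pow (N k : ℕ) :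
    signedRecip (X ^ (k + 1) * (1 + X) ^ N) =
      (-1 : ℚ) ^ (k + 1) * (k.factorial : ℚ) * (N.factorial : ℚ) /
        ((k + 1 + N).factorial : ℚ) := by
  induction N generalizing k with
  | zero =>
    have h := signedRecip_C_mul_X_pow 1 (k + 1)
    have hk : (k.factorial : ℚ) ≠ 0 := by positivity
    simp only [map_one, one_mul, mul_one] at h
    simp only [pow_zero, mul_one, h, Nat.factorial_zero, Nat.cast_one, add_zero,
      Nat.factorial_succ, Nat.cast_mul]
    field_simp
  | succ N ih =>
    have h : (X ^ (k + 1) * (1 + X) ^ (N + 1) : ℚ[X]) =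
        X ^ (k + 1) * (1 + X) ^ N + X ^ (k + 1 + 1) * (1 + X) ^ N := by ring
    have hf : ((k + 1 + N).factorial : ℚ) ≠ 0 := by positivity
    have hn : (k + 1 + N + 1 : ℚ) ≠ 0 := by positivity
    rw [h, map_add, ih, ih, show k + 1 + 1 + N = k + 1 + N + 1 by ring,
      show k + 1 + (N + 1) = k + 1 + N + 1 by ring]
    simp only [Nat.factorial_succ, Nat.cast_mul, Nat.cast_add, Nat.cast_one]
    field_simp
    ring

open Polynomial in
lemma sum_Icc_choose_mul_X_pow (l : ℕ) (hl : 1 ≤ l) :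
    ∑ m ∈ Finset.Icc 1 l, C ((l - 1).choose (m - 1) : ℚ) * X ^ m =
      X * (1 + X) ^ (l - 1) := by
  obtain ⟨r, rfl⟩ := Nat.exists_eq_add_of_le' hl
  rw [← Finset.Ico_add_one_right_eq_Icc, Finset.sum_Ico_eq_sum_range, add_comm 1 X, add_pow,
    Finset.mul_sum]
  refine Finset.sum_congr rfl fun i _ => ?_
  simp only [Nat.add_sub_cancel_left, Nat.add_sub_cancel, one_pow, map_natCast]
  ring


/-- **Evaluation of the coefficients `C_σ`.**
Let `s ≥ 1` and `l₁, …, l_s ≥ 1` be integers with `n = l₁ + ⋯ + l_s`.  Then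
`∑_{1 ≤ m_a ≤ l_a} ((−1)^{Σm_a}/(Σm_a)) ∏_a C(l_a−1, m_a−1)
  = (−1)^s (s−1)! (n−s)! / n!` as rational numbers. -/
theorem coefficient_evaluation (s : ℕ) (hs : 1 ≤ s) (l : Fin s → ℕ)
    (hl : ∀ a, 1 ≤ l a) (n : ℕ) (hn : n = ∑ a, l a) :
    ∑ m ∈ Fintype.piFinset (fun a => Finset.Icc 1 (l a)),
        ((-1 : ℚ) ^ (∑ a, m a) / (∑ a, m a : ℚ)) *
          ∏ a, ((l a - 1).choose (m a - 1) : ℚ) =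
      (-1 : ℚ) ^ s * (Nat.factorial (s - 1)) * (Nat.factorial (n - s)) / (Nat.factorial n) := by
  have hprod : ∏ a, (Polynomial.X * (1 + Polynomial.X) ^ (l a - 1) : Polynomial ℚ) = Polynomial.X ^ s * (1 + Polynomial.X) ^ (n - s) := by
    have hsum : ∑ a, (l a - 1) = n - s := by
      rw [hn, Finset.sum_tsub_distrib _ fun a _ => hl a]
      simp
    rw [Finset.prod_mul_distrib, Finset.prod_pow_eq_pow_sum, hsum]
    simp
  have hexpand : Polynomial.X ^ s * (1 + Polynomial.X) ^ (n - s) =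
      ∑ m ∈ Fintype.piFinset (fun a => Finset.Icc 1 (l a)),
        Polynomial.C (∏ a, ((l a - 1).choose (m a - 1) : ℚ)) * Polynomial.X ^ (∑ a, m a) := by
    rw [← hprod, Finset.prod_congr rfl fun a _ => (sum_Icc_choose_mul_X_pow (l a) (hl a)).symm,
      Finset.prod_univ_sum]
    simp only [Finset.prod_mul_distrib, Finset.prod_pow_eq_pow_sum, map_prod]
  have hsn : s ≤ n := by
    rw [hn]
    simpa using Finset.sum_le_sum fun a (_ : a ∈ Finset.univ) => hl a
  have hval := signedRecip_X_pow_mul_one_add_X_pow (n - s) (s - 1)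
  rw [Nat.sub_add_cancel hs, Nat.add_sub_cancel' hsn, hexpand, map_sum] at hval
  simpa only [signedRecip_C_mul_X_pow, Nat.cast_sum] using hval
end

section
/- Let n ≥ 1, let t₀, …, tₙ be pairwise distinct complex numbers, set 𝒦_{ij} = t_i·t_j/(t_j − t_i), and let g be an antisymmetric complex matrix indexed by {0,…,n} (g_{ij} = −g_{ji}). Then ∑_σ ∏_{j=1}^{n} [ (∑_{i=0}^{j−1} g_{σ(i)σ(j)}) · 𝒦_{σ(j−1)σ(j)} ] = ∑_p ∏_{i=1}^{n} g_{p(i),i} · 𝒦_{p(i),i}, where: σ ranges over all bijections of {0,…,n} with σ(0) = 0; and p ranges over all functions p : {0,…,n} → {0,…,n} with p(0) = 0 such that for every i there exists k with the k-fold iterate p^{[k]}(i) = 0 (i.e., p encodes a rooted tree on {0,…,n} with root 0 and parent map p). -/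
/-- The Lagrange partial fraction expansion, written with the kernel `a b / (b - a)`. -/
theorem prod_kernel_eq_sum {V : Type*} [DecidableEq V] (t : V → ℂ) (ht : Function.Injective t)
    (R : Finset V) (hR : R.Nonempty) (v : V) (hv : v ∉ R) :
    ∏ r ∈ R, t v * t r / (t r - t v) =
      ∑ x ∈ R, t v * t x / (t x - t v) * ∏ r ∈ R.erase x, t x * t r / (t r - t x) := by
  by_cases h0 : t v = 0
  · obtain ⟨r, hr⟩ := hR
    rw [Finset.prod_eq_zero hr (by simp [h0])]
    simp [h0]
  by_cases h1 : ∃ r ∈ R, t r = 0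
  · obtain ⟨r, hr, hr0⟩ := h1
    rw [Finset.prod_eq_zero hr (by simp [hr0])]
    refine (Finset.sum_eq_zero fun x hx => ?_).symm
    by_cases hxr : x = r
    · simp [hxr, hr0]
    · rw [Finset.prod_eq_zero (Finset.mem_erase.2 ⟨Ne.symm hxr, hr⟩) (by simp [hr0]), mul_zero]
  push Not at h1
  have key : ∀ a b, t a ≠ 0 → t b ≠ 0 →
      t a * t b / (t b - t a) = ((t a)⁻¹ - (t b)⁻¹)⁻¹ := by
    intro a b ha hb
    rw [inv_sub_inv ha hb, inv_div]
  have hinj : Function.Injective fun a => (t a)⁻¹ := fun a b h => ht (inv_injective h)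
  have hsum := congrArg (Polynomial.eval (t v)⁻¹)
    (Lagrange.sum_basis (s := R) (hinj.injOn) hR)
  simp only [Polynomial.eval_finsetSum, Lagrange.basis, Polynomial.eval_prod,
    Lagrange.basisDivisor, Polynomial.eval_mul, Polynomial.eval_C, Polynomial.eval_sub,
    Polynomial.eval_X, Polynomial.eval_one] at hsum
  rw [Finset.prod_congr rfl fun r hr => key v r h0 (h1 r hr), ← mul_one (∏ r ∈ R, _), ← hsum,
    Finset.mul_sum]
  refine Finset.sum_congr rfl fun x hx => ?_
  rw [key v x h0 (h1 x hx), Finset.prod_congr rfl fun r hr =>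
    key x r (h1 x hx) (h1 r (Finset.mem_of_mem_erase hr)), ← Finset.mul_prod_erase _ _ hx,
    mul_assoc, ← Finset.prod_mul_distrib]
  congr 1
  refine Finset.prod_congr rfl fun r hr => ?_
  have hne : (t v)⁻¹ - (t r)⁻¹ ≠ 0 := sub_ne_zero.2 fun h =>
    hv (hinj h ▸ Finset.mem_of_mem_erase hr)
  rw [mul_left_comm, inv_mul_cancel₀ hne, mul_one]

/-- The weight of the part of the tree `p` outside `S`, with all its roots attached to `v`. -/
def forestWeight {V : Type*} [Fintype V] [DecidableEq V] (K : V → V → ℂ) (p : V → V)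
    (S : Finset V) (v : V) : ℂ :=
  ∏ i ∈ Sᶜ, K (if p i ∈ S then v else p i) i

theorem exists_notMem_apply_mem {V : Type*} (p : V → V) (S : Finset V) (a r : V) (hr : r ∈ S)
    (ha : a ∉ S) (k : ℕ) (hk : p^[k] a = r) : ∃ x, x ∉ S ∧ p x ∈ S := by
  induction k generalizing a with
  | zero => exact absurd (show a = r from hk ▸ rfl) (ne_of_mem_of_not_mem hr ha).symm
  | succ k ih =>
    by_cases h : p a ∈ S
    · exact ⟨a, ha, h⟩
    · exact ih (p a) h hk

theorem forestWeight_eq_sum {V : Type*} [Fintype V] [DecidableEq V] (K : V → V → ℂ)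
    (hK : ∀ (R : Finset V) (v : V), R.Nonempty → v ∉ R →
      ∏ r ∈ R, K v r = ∑ x ∈ R, K v x * ∏ r ∈ R.erase x, K x r)
    (p : V → V) (r : V) (hp : ∀ i, ∃ k, p^[k] i = r) (S : Finset V) (hr : r ∈ S)
    (hS : S ≠ Finset.univ) (v : V) (hv : v ∈ S) :
    forestWeight K p S v =
      ∑ x with x ∉ S ∧ p x ∈ S, K v x * forestWeight K p (insert x S) x := by
  set R : Finset V := Finset.univ.filter fun x => x ∉ S ∧ p x ∈ S with hRdef
  set Q : Finset V := Finset.univ.filter fun x => x ∉ S ∧ p x ∉ S with hQdef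
  have hR : R.Nonempty := by
    obtain ⟨a, ha⟩ : ∃ a, a ∉ S := by
      by_contra! h
      exact hS (Finset.eq_univ_iff_forall.2 h)
    obtain ⟨k, hk⟩ := hp a
    obtain ⟨x, hx⟩ := exists_notMem_apply_mem p S a r hr ha k hk
    exact ⟨x, by simpa [hRdef] using hx⟩
  have h1 : forestWeight K p S v = (∏ i ∈ R, K v i) * ∏ i ∈ Q, K (p i) i := by
    have hU : Sᶜ = R ∪ Q := by ext; simp [R, Q]; tauto
    rw [forestWeight, hU, Finset.prod_union]
    · congr 1 <;> refine Finset.prod_congr rfl fun i hi => ?_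
      · rw [if_pos (by simp_all [R])]
      · rw [if_neg (by simp_all [Q])]
    · rw [Finset.disjoint_left]; simp +contextual [R, Q]
  have h2 : ∀ x ∈ R, forestWeight K p (insert x S) x =
      (∏ i ∈ R.erase x, K x i) * ∏ i ∈ Q, K (p i) i := by
    intro x hx
    have hU : (insert x S)ᶜ = R.erase x ∪ Q := by
      ext i
      by_cases hi : i = x
      · subst hi; simp_all [R, Q]
      · simp [R, Q, hi]; tauto
    rw [forestWeight, hU, Finset.prod_union]
    · congr 1 <;> refine Finset.prod_congr rfl fun i hi => ?_
      · rw [if_pos (by simp_all [R])]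
      · by_cases h : p i = x
        · rw [if_pos (by simp [h]), h]
        · rw [if_neg (by simp_all [Q])]
    · rw [Finset.disjoint_left]; simp +contextual [R, Q]
  rw [h1, hK R v hR (by simp [R, hv]), Finset.sum_mul]
  exact Finset.sum_congr rfl fun x hx => by rw [h2 x hx, mul_assoc]

/-- `s` is an injective sequence starting at `r` in which every later entry comes after its
parent under `p`. -/
def IsLinearPrefix {V : Type*} (p : V → V) (r : V) (k : ℕ) (s : Fin (k + 1) → V) : Prop :=
  Function.Injective s ∧ s 0 = r ∧ ∀ j, j ≠ 0 → ∃ i < j, s i = p (s j)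

theorem isLinearPrefix_snoc {V : Type*} (p : V → V) (r : V) (k : ℕ) (s : Fin (k + 1) → V)
    (x : V) : IsLinearPrefix p r (k + 1) (Fin.snoc s x : Fin (k + 2) → V) ↔
      IsLinearPrefix p r k s ∧ x ∉ Set.range s ∧ p x ∈ Set.range s := by
  have h0 : (Fin.snoc s x : Fin (k + 2) → V) 0 = s 0 := by
    rw [← Fin.castSucc_zero, Fin.snoc_castSucc (α := fun _ => V)]
  simp only [IsLinearPrefix, Fin.snoc_injective_iff, h0, Fin.forall_fin_succ' (n := k + 1),
    Fin.exists_fin_succ' (n := k + 1), Fin.snoc_castSucc (α := fun _ => V), Fin.snoc_last]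
  simp [Fin.castSucc_lt_last, Fin.castSucc_lt_castSucc_iff, (Fin.le_last _).not_gt]
  tauto

open scoped Classical in
theorem sum_linearPrefix_eq {V : Type*} [Fintype V] [DecidableEq V] (K : V → V → ℂ)
    (hK : ∀ (R : Finset V) (v : V), R.Nonempty → v ∉ R →
      ∏ r ∈ R, K v r = ∑ x ∈ R, K v x * ∏ r ∈ R.erase x, K x r)
    (p : V → V) (r : V) (hp : ∀ i, ∃ k, p^[k] i = r) (k : ℕ) (hk : k < Fintype.card V) :
    ∑ s : Fin (k + 1) → V with IsLinearPrefix p r k s,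
      (∏ j : Fin k, K (s j.castSucc) (s j.succ)) *
        forestWeight K p (Finset.univ.image s) (s (Fin.last k)) = forestWeight K p {r} r := by
  induction k with
  | zero =>
    have : Subsingleton (Fin (0 + 1)) := inferInstanceAs (Subsingleton (Fin 1))
    rw [Finset.sum_eq_single (fun _ => r)]
    · simp
    · intro s hs hne
      exact absurd (funext fun i => by rw [Subsingleton.elim i 0, (Finset.mem_filter.1 hs).2.2.1])
        hne
    · intro h
      refine absurd (Finset.mem_filter.2 ⟨Finset.mem_univ _, ?_, rfl, ?_⟩) h
      · exact Function.injective_of_subsingleton _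
      · exact fun j hj => absurd (Subsingleton.elim j 0) hj
  | succ k ih =>
    rw [← ih (by omega), Finset.sum_filter, Finset.sum_filter,
      ← (Fin.snocEquiv fun _ : Fin (k + 2) => V).sum_comp, Fintype.sum_prod_type_right]
    refine Finset.sum_congr rfl fun s _ => ?_
    have hsnoc : ∀ x, Fin.snocEquiv (fun _ : Fin (k + 2) => V) (x, s) = Fin.snoc s x :=
      fun _ => rfl
    simp only [hsnoc, isLinearPrefix_snoc]
    by_cases hs : IsLinearPrefix p r k s
    · rw [if_pos hs, forestWeight_eq_sum K hK p r hp (Finset.univ.image s)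
        (Finset.mem_image.2 ⟨0, Finset.mem_univ _, hs.2.1⟩) _ _
        (Finset.mem_image_of_mem _ (Finset.mem_univ _)), Finset.mul_sum, Finset.sum_filter]
      · refine Finset.sum_congr rfl fun x _ => ?_
        have himg : Finset.univ.image (Fin.snoc s x : Fin (k + 2) → V) =
            insert x (Finset.univ.image s) := by
          ext y
          simp [Fin.exists_fin_succ' (n := k + 1), eq_comm, or_comm]
        simp only [hs, true_and, Set.mem_range, Finset.mem_image, Finset.mem_univ]
        refine if_congr Iff.rfl ?_ rfl
        rw [himg, Fin.prod_univ_castSucc]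
        simp [← Fin.castSucc_succ, mul_assoc]
      · intro h
        have := congrArg Finset.card h
        rw [Finset.card_image_of_injective _ hs.1, Finset.card_univ, Finset.card_univ,
          Fintype.card_fin] at this
        omega
    · simp [hs]

theorem exists_iterate_eq_of_isLinearPrefix {V : Type*} (p : V → V) (r : V) (k : ℕ)
    (s : Fin (k + 1) → V) (hs : IsLinearPrefix p r k s) (j : Fin (k + 1)) :
    ∃ m, p^[m] (s j) = r := by
  induction j using WellFoundedLT.induction with
  | ind j ih =>
    by_cases hj : j = 0
    · exact ⟨0, by simp [hj, hs.2.1]⟩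
    · obtain ⟨i, hij, hi⟩ := hs.2.2 j hj
      obtain ⟨m, hm⟩ := ih i hij
      exact ⟨m + 1, by rw [Function.iterate_succ_apply, ← hi, hm]⟩

theorem isLinearPrefix_perm_iff {n : ℕ} (q : Fin n → Fin (n + 1))
    (σ : Equiv.Perm (Fin (n + 1))) (hσ : σ 0 = 0) :
    IsLinearPrefix (Fin.cons 0 q : Fin (n + 1) → Fin (n + 1)) 0 n σ ↔
      ∀ i, σ.symm (q i) < σ.symm i.succ := by
  constructor
  · intro h i
    obtain ⟨a, ha, haq⟩ := h.2.2 (σ.symm i.succ) (by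
      intro h0
      rw [Equiv.symm_apply_eq, hσ] at h0
      exact Fin.succ_ne_zero i h0)
    rw [Equiv.apply_symm_apply, Fin.cons_succ] at haq
    rwa [← haq, Equiv.symm_apply_apply]
  · refine fun h => ⟨σ.injective, hσ, fun j hj => ?_⟩
    obtain ⟨i, hi⟩ := Fin.exists_succ_eq.2 (show σ j ≠ 0 from fun h0 => hj (σ.injective
      (h0.trans hσ.symm)))
    refine ⟨σ.symm (q i), ?_, ?_⟩
    · simpa [hi] using h i
    · rw [← hi, Equiv.apply_symm_apply, Fin.cons_succ]

theorem prod_sum_perm_eq_sum_prod {n : ℕ} (g : Fin (n + 1) → Fin (n + 1) → ℂ)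
    (σ : Equiv.Perm (Fin (n + 1))) (hσ : σ 0 = 0) :
    ∏ j : Fin n, ∑ i ∈ Finset.Iio j.succ, g (σ i) (σ j.succ) =
      ∑ q : Fin n → Fin (n + 1),
        if ∀ i, σ.symm (q i) < σ.symm i.succ then ∏ i, g (q i) i.succ else 0 := by
  let φ : Fin (n + 1) → ℂ := fun x =>
    if x = 0 then 1 else ∑ y, if σ.symm y < σ.symm x then g y x else 0
  have h1 : ∏ j : Fin n, ∑ i ∈ Finset.Iio j.succ, g (σ i) (σ j.succ) = ∏ j, φ (σ j) := by
    rw [Fin.prod_univ_succ, hσ]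
    simp only [φ, if_true, one_mul]
    refine Finset.prod_congr rfl fun j _ => ?_
    rw [if_neg (fun h => Fin.succ_ne_zero j (σ.injective (h.trans hσ.symm))),
      ← Equiv.sum_comp σ (fun y => if σ.symm y < _ then g y _ else 0)]
    simp only [Equiv.symm_apply_apply]
    rw [← Finset.sum_filter]
    exact Finset.sum_congr (by ext; simp) fun _ _ => rfl
  rw [h1, Equiv.prod_comp σ φ, Fin.prod_univ_succ]
  simp only [φ, if_true, one_mul, Fin.succ_ne_zero, if_false]
  rw [Finset.prod_univ_sum, Fintype.piFinset_univ]
  refine Finset.sum_congr rfl fun q _ => ?_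
  rw [Finset.prod_ite_zero]
  simp

open scoped Classical in
theorem sum_perm_isLinearPrefix {n : ℕ} (K : Fin (n + 1) → Fin (n + 1) → ℂ)
    (hK : ∀ (R : Finset (Fin (n + 1))) (v : Fin (n + 1)), R.Nonempty → v ∉ R →
      ∏ r ∈ R, K v r = ∑ x ∈ R, K v x * ∏ r ∈ R.erase x, K x r)
    (q : Fin n → Fin (n + 1)) :
    ∑ σ ∈ Finset.univ.filter (fun σ : Equiv.Perm (Fin (n + 1)) =>
        IsLinearPrefix (Fin.cons 0 q : Fin (n + 1) → Fin (n + 1)) 0 n σ),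
      ∏ j : Fin n, K (σ j.castSucc) (σ j.succ) =
    if ∀ i, ∃ k : ℕ, (Fin.cons 0 q : Fin (n + 1) → Fin (n + 1))^[k] i = 0 then
      ∏ i : Fin n, K (q i) i.succ else 0 := by
  set p : Fin (n + 1) → Fin (n + 1) := Fin.cons 0 q with hp
  split_ifs with htree
  · have h := sum_linearPrefix_eq K hK p 0 htree n (by simp)
    have hroot : forestWeight K p {0} 0 = ∏ i : Fin n, K (q i) i.succ := by
      have hc : ({0} : Finset (Fin (n + 1)))ᶜ = Finset.univ.map (Fin.succEmb n) := by
        ext x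
        simp [← Fin.exists_succ_eq]
      rw [forestWeight, hc, Finset.prod_map]
      refine Finset.prod_congr rfl fun i _ => ?_
      simp only [Fin.coe_succEmb, hp, Fin.cons_succ, Finset.mem_singleton]
      split_ifs with hq
      · rw [hq]
      · rfl
    rw [← hroot, ← h]
    refine Finset.sum_bij (fun σ _ => σ) (fun σ hσ => by simpa using hσ)
      (fun _ _ _ _ h => DFunLike.coe_injective h) (fun s hs => ?_) (fun σ _ => ?_)
    · have hs' := (Finset.mem_filter.1 hs).2
      exact ⟨Equiv.ofBijective s (Finite.injective_iff_bijective.1 hs'.1),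
        by simpa using hs', rfl⟩
    · rw [Finset.image_univ_of_surjective σ.surjective]
      simp [forestWeight]
  · refine Finset.sum_eq_zero fun σ hσ => absurd (fun i => ?_) htree
    have := exists_iterate_eq_of_isLinearPrefix p 0 n σ (Finset.mem_filter.1 hσ).2 (σ.symm i)
    rwa [Equiv.apply_symm_apply] at this

open scoped Classical in
/-- **Equality of the linear-chain and rooted-tree expansions (Appendix C.2).**
Let `t₀, …, tₙ` be pairwise distinct complex numbers, `𝒦_{ij} = t_i t_j/(t_j − t_i)`,
and `g` an antisymmetric complex matrix indexed by `{0,…,n}`.  Then the sum over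
enumerations `σ` (bijections with `σ(0)=0`) of the nested linear-chain products
`∏_{j=1}^n (∑_{i=0}^{j−1} g_{σ(i)σ(j)}) 𝒦_{σ(j−1)σ(j)}` equals the sum over all
rooted trees on `{0,…,n}` with root `0` (encoded by parent maps `p` with `p(0)=0`
and every iterate reaching `0`) of `∏_{i=1}^n g_{p(i),i} 𝒦_{p(i),i}`. -/
theorem linear_chain_eq_tree_sum (n : ℕ) (hn : 1 ≤ n) (t : Fin (n + 1) → ℂ)
    (ht : Function.Injective t) (g : Fin (n + 1) → Fin (n + 1) → ℂ)
    (hg : ∀ i j, g i j = -g j i) :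
    ∑ σ ∈ Finset.univ.filter (fun σ : Equiv.Perm (Fin (n + 1)) => σ 0 = 0),
        ∏ j : Fin n,
          ((∑ i ∈ Finset.Iio j.succ, g (σ i) (σ j.succ)) *
            (t (σ j.castSucc) * t (σ j.succ) / (t (σ j.succ) - t (σ j.castSucc)))) =
      ∑ p ∈ Finset.univ.filter (fun p : Fin (n + 1) → Fin (n + 1) =>
          p 0 = 0 ∧ ∀ i, ∃ k : ℕ, p^[k] i = 0),
        ∏ i : Fin n,
          g (p i.succ) i.succ * (t (p i.succ) * t i.succ / (t i.succ - t (p i.succ))) := by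
  let K : Fin (n + 1) → Fin (n + 1) → ℂ := fun a b => t a * t b / (t b - t a)
  have hK : ∀ (R : Finset (Fin (n + 1))) (v : Fin (n + 1)), R.Nonempty → v ∉ R →
      ∏ r ∈ R, K v r = ∑ x ∈ R, K v x * ∏ r ∈ R.erase x, K x r :=
    fun R v hR hv => prod_kernel_eq_sum t ht R hR v hv
  have hL : ∀ σ ∈ Finset.univ.filter (fun σ : Equiv.Perm (Fin (n + 1)) => σ 0 = 0),
      ∏ j : Fin n, ((∑ i ∈ Finset.Iio j.succ, g (σ i) (σ j.succ)) *
        (t (σ j.castSucc) * t (σ j.succ) / (t (σ j.succ) - t (σ j.castSucc)))) =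
      ∑ q : Fin n → Fin (n + 1),
        if IsLinearPrefix (Fin.cons 0 q : Fin (n + 1) → Fin (n + 1)) 0 n σ then
          (∏ i, g (q i) i.succ) * ∏ j : Fin n, K (σ j.castSucc) (σ j.succ) else 0 := by
    intro σ hσ
    have hσ0 := (Finset.mem_filter.1 hσ).2
    rw [Finset.prod_mul_distrib, prod_sum_perm_eq_sum_prod g σ hσ0, Finset.sum_mul]
    refine Finset.sum_congr rfl fun q _ => ?_
    rw [ite_mul, zero_mul]
    exact if_congr (isLinearPrefix_perm_iff q σ hσ0).symm rfl rfl
  rw [Finset.sum_congr rfl hL, Finset.sum_comm, Finset.sum_filter,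
    ← (Fin.consEquiv fun _ : Fin (n + 1) => Fin (n + 1)).sum_comp, Fintype.sum_prod_type_right]
  refine Finset.sum_congr rfl fun q _ => ?_
  have hcons : ∀ x, Fin.consEquiv (fun _ : Fin (n + 1) => Fin (n + 1)) (x, q) = Fin.cons x q :=
    fun _ => rfl
  rw [Finset.sum_eq_single (0 : Fin (n + 1))
    (fun x _ hx => if_neg fun h => hx (by simpa [hcons] using h.1)) (by simp)]
  simp only [hcons, Fin.cons_zero, Fin.cons_succ, true_and]
  rw [← Finset.sum_filter, Finset.filter_filter, ← Finset.mul_sum, Finset.prod_mul_distrib,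
    ← mul_ite_zero, ← sum_perm_isLinearPrefix K hK q]
  exact congrArg _ (Finset.sum_congr (Finset.filter_congr fun σ _ =>
    ⟨fun h => h.2, fun h => ⟨h.2.1, h⟩⟩) fun _ _ => rfl)
end
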